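/- arXiv:2410.06117 — 6 statements merged into one kernel-verified Lean document; each statement's English description precedes it below -/
import Mathlib

section
/- Let T > 0 and let π_T be the Poisson measure on ℕ with intensity T, π_T(k) = e^{-T} T^k / k!. Let f : ℕ → (0,∞) be such that Σ_k f(k) π_T(k) < ∞ and Σ_k f(k) |log f(k)| π_T(k) < ∞. Then Ent_{π_T}[f] ≤ T · Σ_{k=0}^∞ f(k+1) { log( f(k+1)/f(k) ) − 1 + f(k)/f(k+1) } π_T(k), where the right-hand side is interpreted as an extended real (each summand is nonnegative). -/
open scoped ENNReal

/-- The Poisson measure on ℕ with intensity `t`: `π_t(k) = e^{-t} t^k / k!`. -/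
noncomputable def poissonPMF (t : ℝ) (k : ℕ) : ℝ :=
  Real.exp (-t) * t ^ k / (Nat.factorial k)

/-- The entropy `Ent_{π_T}[f] = Σ f log f dπ_T − (Σ f dπ_T) log (Σ f dπ_T)`. -/
noncomputable def entPoisson (T : ℝ) (f : ℕ → ℝ) : ℝ :=
  (∑' k : ℕ, f k * Real.log (f k) * poissonPMF T k)
    - (∑' k : ℕ, f k * poissonPMF T k) * Real.log (∑' k : ℕ, f k * poissonPMF T k)

/-- The summand on the right-hand side of Wu's inequality. -/
noncomputable def wuTerm (T : ℝ) (f : ℕ → ℝ) (k : ℕ) : ℝ :=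
  f (k + 1) * (Real.log (f (k + 1) / f k) - 1 + f k / f (k + 1)) * poissonPMF T k

open Filter Topology

/-- The mean of `φ` under the binomial law with `n` trials and success probability `p`,
defined by adding the trials one at a time. -/
noncomputable def binomialMean (p : ℝ) : ℕ → (ℕ → ℝ) → ℝ
  | 0, φ => φ 0
  | n + 1, φ => binomialMean p n fun k => (1 - p) * φ k + p * φ (k + 1)

/-- The Bregman divergence of `x ↦ x log x`, between `y` and `x`. -/
noncomputable def entropyBregman (y x : ℝ) : ℝ :=
  y * (Real.log (y / x) - 1 + x / y)

lemma binomialMean_eq_sum (p : ℝ) (n : ℕ) (φ : ℕ → ℝ) :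
    binomialMean p n φ =
      ∑ k ∈ Finset.range (n + 1), (n.choose k * p ^ k * (1 - p) ^ (n - k)) * φ k := by
  induction n generalizing φ with
  | zero => simp [binomialMean]
  | succ n ih =>
    have hshift : ∑ k ∈ Finset.range (n + 1),
          (n.choose (k + 1) * p ^ (k + 1) * (1 - p) ^ (n - k)) * φ (k + 1)
            + (1 - p) ^ (n + 1) * φ 0 =
        ∑ k ∈ Finset.range (n + 1), (n.choose k * p ^ k * (1 - p) ^ (n + 1 - k)) * φ k := by
      have h := Finset.sum_range_succ'
        (fun k => (n.choose k * p ^ k * (1 - p) ^ (n + 1 - k)) * φ k) (n + 1)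
      rw [Finset.sum_range_succ] at h
      simpa using h.symm
    rw [binomialMean, ih, Finset.sum_range_succ' _ (n + 1)]
    simp only [Nat.choose_succ_succ, Nat.add_sub_add_right, Nat.cast_add, Nat.choose_zero_right,
      Nat.cast_one, pow_zero, one_mul, Nat.sub_zero, add_mul, mul_add, Finset.sum_add_distrib]
    rw [add_assoc, hshift, add_comm]
    congr 1
    · exact Finset.sum_congr rfl fun k _ => by ring
    · refine Finset.sum_congr rfl fun k hk => ?_
      rw [Nat.succ_sub (Nat.lt_succ_iff.mp (Finset.mem_range.mp hk)), pow_succ]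
      ring

lemma binomialMean_mono {p : ℝ} (hp0 : 0 ≤ p) (hp1 : p ≤ 1) (n : ℕ) {φ ψ : ℕ → ℝ}
    (h : ∀ k, φ k ≤ ψ k) : binomialMean p n φ ≤ binomialMean p n ψ := by
  have hq : 0 ≤ 1 - p := sub_nonneg.mpr hp1
  rw [binomialMean_eq_sum, binomialMean_eq_sum]
  exact Finset.sum_le_sum fun k _ => mul_le_mul_of_nonneg_left (h k) (by positivity)

lemma binomialMean_add_const_mul (p c : ℝ) (n : ℕ) (φ ψ : ℕ → ℝ) :
    binomialMean p n (fun k => φ k + c * ψ k) =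
      binomialMean p n φ + c * binomialMean p n ψ := by
  simp only [binomialMean_eq_sum, Finset.mul_sum, ← Finset.sum_add_distrib]
  exact Finset.sum_congr rfl fun k _ => by ring

lemma entropyBregman_nonneg {x y : ℝ} (hx : 0 < x) (hy : 0 < y) : 0 ≤ entropyBregman y x := by
  have h := Real.one_sub_inv_le_log_of_pos (div_pos hy hx)
  rw [inv_div] at h
  exact mul_nonneg hy.le (by linarith)

lemma tangent_le_mul_log_div {x y z : ℝ} (hx : 0 < x) (hy : 0 < y) (hz : 0 < z) :
    y * Real.log z + y - z * x ≤ y * Real.log (y / x) := by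
  have h := Real.one_sub_inv_le_log_of_pos (div_pos (div_pos hy hx) hz)
  rw [Real.log_div (div_pos hy hx).ne' hz.ne'] at h
  have h' := mul_le_mul_of_nonneg_left h hy.le
  have e : y * (1 - (y / x / z)⁻¹) = y - z * x := by field_simp
  linarith

lemma convexCombo_pos {p a b : ℝ} (hp0 : 0 ≤ p) (hp1 : p ≤ 1) (ha : 0 < a) (hb : 0 < b) :
    0 < (1 - p) * a + p * b :=
  convex_Ioi (0 : ℝ) ha hb (sub_nonneg.mpr hp1) hp0 (sub_add_cancel 1 p)

lemma mul_log_convexCombo_le {p x y : ℝ} (hp0 : 0 ≤ p) (hp1 : p ≤ 1) (hx : 0 < x) (hy : 0 < y) :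
    (1 - p) * (x * Real.log x) + p * (y * Real.log y) ≤
      ((1 - p) * x + p * y) * Real.log ((1 - p) * x + p * y) + p * entropyBregman y x := by
  have hs := convexCombo_pos hp0 hp1 hx hy
  have h := tangent_le_mul_log_div one_pos hs hx
  have e : entropyBregman y x = y * Real.log y - y * Real.log x - y + x := by
    rw [entropyBregman, Real.log_div hy.ne' hx.ne']
    field_simp
  rw [div_one] at h
  rw [e]
  linarith

/-- Joint convexity of the Bregman divergence of `x ↦ x log x`. -/
lemma entropyBregman_convexCombo_le {p x y x' y' : ℝ} (hp0 : 0 ≤ p) (hp1 : p ≤ 1)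
    (hx : 0 < x) (hy : 0 < y) (hx' : 0 < x') (hy' : 0 < y') :
    entropyBregman ((1 - p) * y + p * y') ((1 - p) * x + p * x') ≤
      (1 - p) * entropyBregman y x + p * entropyBregman y' x' := by
  have e : ∀ {a b : ℝ}, 0 < b →
      entropyBregman b a = b * Real.log (b / a) - b + a := fun {a b} hb => by
    rw [entropyBregman]
    field_simp
  have hX := convexCombo_pos hp0 hp1 hx hx'
  have hY := convexCombo_pos hp0 hp1 hy hy'
  rw [e hY, e hy, e hy']
  set X := (1 - p) * x + p * x' with hXdef
  set Y := (1 - p) * y + p * y' with hYdef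
  have h := mul_le_mul_of_nonneg_left (tangent_le_mul_log_div hx hy (div_pos hY hX))
    (sub_nonneg.mpr hp1)
  have h' := mul_le_mul_of_nonneg_left (tangent_le_mul_log_div hx' hy' (div_pos hY hX)) hp0
  have hz : Y / X * ((1 - p) * x + p * x') = Y := div_mul_cancel₀ _ hX.ne'
  have hlog : Y * Real.log (Y / X) =
    (1 - p) * (y * Real.log (Y / X)) + p * (y' * Real.log (Y / X)) := by
    rw [hYdef]; ring
  linarith

/-- The modified logarithmic Sobolev inequality for binomial laws. -/
lemma binomialMean_mul_log_le {p : ℝ} (hp0 : 0 ≤ p) (hp1 : p ≤ 1) (n : ℕ) {f : ℕ → ℝ}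
    (hf : ∀ k, 0 < f k) :
    binomialMean p n (fun k => f k * Real.log (f k)) ≤
      binomialMean p n f * Real.log (binomialMean p n f) +
        n * p * binomialMean p (n - 1) fun k => entropyBregman (f (k + 1)) (f k) := by
  induction n generalizing f with
  | zero => simp [binomialMean]
  | succ n ih =>
    have hstep := binomialMean_mono hp0 hp1 n fun k =>
      mul_log_convexCombo_le hp0 hp1 (hf k) (hf (k + 1))
    rw [binomialMean_add_const_mul p p n
      (fun k => ((1 - p) * f k + p * f (k + 1)) * Real.log ((1 - p) * f k + p * f (k + 1)))
      fun k => entropyBregman (f (k + 1)) (f k)] at hstep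
    have hIH := ih fun k => convexCombo_pos hp0 hp1 (hf k) (hf (k + 1))
    have hconv : (n : ℝ) * p * binomialMean p (n - 1) (fun k => entropyBregman
          ((1 - p) * f (k + 1) + p * f (k + 1 + 1)) ((1 - p) * f k + p * f (k + 1))) ≤
        n * p * binomialMean p n fun k => entropyBregman (f (k + 1)) (f k) := by
      cases n with
      | zero => simp
      | succ m =>
        refine mul_le_mul_of_nonneg_left ?_ (by positivity)
        exact binomialMean_mono hp0 hp1 m fun k => entropyBregman_convexCombo_le hp0 hp1
          (hf k) (hf (k + 1)) (hf (k + 1)) (hf (k + 1 + 1))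
    simp only [binomialMean, Nat.add_sub_cancel, Nat.cast_add, Nat.cast_one] at *
    linarith

/-- Poisson limit theorem for means of functions integrable for the limiting Poisson law. -/
lemma tendsto_binomialMean {T : ℝ} (hT : 0 ≤ T) {p : ℕ → ℝ} (hp0 : ∀ n, 0 ≤ p n)
    (hpT : ∀ n, n * p n ≤ T) (hp : Tendsto (fun n : ℕ => n * p n) atTop (𝓝 T)) {φ : ℕ → ℝ}
    (hφ : Summable fun k => φ k * poissonPMF T k) :
    Tendsto (fun n => binomialMean (p n) n φ) atTop (𝓝 (∑' k, φ k * poissonPMF T k)) := by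
  have hsum : ∀ n, binomialMean (p n) n φ =
      ∑' k, (n.choose k * p n ^ k * (1 - p n) ^ (n - k)) * φ k := fun n => by
    rw [binomialMean_eq_sum]
    refine (tsum_eq_sum fun k hk => ?_).symm
    rw [Nat.choose_eq_zero_of_lt (by simpa using hk)]
    simp
  simp only [hsum]
  refine tendsto_tsum_of_dominated_convergence
    (bound := fun k => Real.exp T * |φ k * poissonPMF T k|) (hφ.abs.mul_left _) (fun k => ?_) ?_
  · rw [mul_comm (φ k)]
    exact (ProbabilityTheory.tendsto_choose_mul_pow_of_tendsto_mul_atTop k hp).mul_const _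
  · have hp_le : ∀ᶠ n in atTop, p n ≤ 1 :=
      (ProbabilityTheory.tendsto_zero_of_tendsto_mul_atTop hp).eventually (Iic_mem_nhds one_pos)
    filter_upwards [hp_le] with n hn k
    have hpn := hp0 n
    have hq : 0 ≤ 1 - p n := sub_nonneg.mpr hn
    have hweight : n.choose k * p n ^ k * (1 - p n) ^ (n - k) ≤ Real.exp T * poissonPMF T k :=
      calc n.choose k * p n ^ k * (1 - p n) ^ (n - k)
        _ ≤ n.choose k * p n ^ k :=
          mul_le_of_le_one_right (by positivity) (pow_le_one₀ hq (by linarith))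
        _ ≤ n ^ k / k.factorial * p n ^ k := by
          gcongr
          exact Nat.choose_le_pow_div k n
        _ = (n * p n) ^ k / k.factorial := by ring
        _ ≤ T ^ k / k.factorial := by
          gcongr
          exact hpT n
        _ = Real.exp T * poissonPMF T k := by
          rw [poissonPMF, Real.exp_neg]
          field_simp
    have hπ : 0 ≤ poissonPMF T k := by
      rw [poissonPMF]
      positivity
    rw [Real.norm_eq_abs, abs_mul, abs_mul (φ k), abs_of_nonneg hπ, abs_of_nonneg (by positivity)]
    calc _ ≤ (Real.exp T * poissonPMF T k) * |φ k| := by gcongr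
      _ = _ := by ring

lemma entPoisson_le_of_summable {T : ℝ} (hT : 0 < T) {f : ℕ → ℝ} (hf : ∀ k, 0 < f k)
    (h1 : Summable fun k => f k * poissonPMF T k)
    (h2 : Summable fun k => f k * Real.log (f k) * poissonPMF T k)
    (h3 : Summable (wuTerm T f)) :
    entPoisson T f ≤ T * ∑' k, wuTerm T f k := by
  have hmul : ∀ n : ℕ, ((n + 1 : ℕ) : ℝ) * (T / (n + 1 : ℕ)) = T := fun n =>
    mul_div_cancel₀ _ (by positivity)
  have hp : Tendsto (fun n : ℕ => (n : ℝ) * (T / n)) atTop (𝓝 T) := by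
    refine tendsto_const_nhds.congr' ?_
    filter_upwards [eventually_gt_atTop 0] with n hn
    field_simp
  have hpT : ∀ n : ℕ, (n : ℝ) * (T / n) ≤ T := fun n => by
    cases n with
    | zero => simpa using hT.le
    | succ n => exact (hmul n).le
  have hp' : Tendsto (fun n : ℕ => (n : ℝ) * (T / (n + 1 : ℕ))) atTop (𝓝 T) := by
    have h := (tendsto_natCast_div_add_atTop (1 : ℝ)).const_mul T
    rw [mul_one] at h
    refine h.congr fun n => ?_
    push_cast
    ring
  have hpT' : ∀ n : ℕ, (n : ℝ) * (T / (n + 1 : ℕ)) ≤ T := fun n => by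
    refine le_of_le_of_eq ?_ (hmul n)
    gcongr
    simp
  have hp0 : ∀ n : ℕ, 0 ≤ T / (n : ℝ) := fun n => by positivity
  have hmean := (tendsto_binomialMean hT.le hp0 hpT hp h1).comp (tendsto_add_atTop_nat 1)
  have hent := (tendsto_binomialMean hT.le hp0 hpT hp h2).comp (tendsto_add_atTop_nat 1)
  have hrhs := (tendsto_binomialMean (φ := fun k => entropyBregman (f (k + 1)) (f k)) hT.le
    (fun n => hp0 (n + 1)) hpT' hp' h3).const_mul T
  have hmlog := (Real.continuous_mul_log.tendsto _).comp hmean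
  rw [entPoisson, sub_le_iff_le_add']
  refine le_of_tendsto_of_tendsto hent (hmlog.add hrhs) ?_
  filter_upwards [eventually_ge_atTop ⌈T⌉₊] with n hn
  have hle : T / ((n + 1 : ℕ) : ℝ) ≤ 1 := by
    rw [div_le_one (by positivity)]
    push_cast
    linarith [Nat.ceil_le.mp hn]
  have h := binomialMean_mul_log_le (hp0 (n + 1)) hle (n + 1) hf
  rw [hmul] at h
  exact h

/-- **Wu's modified logarithmic Sobolev inequality** for the Poisson measure `π_T`.
The right-hand side is interpreted as an extended real: each summand is nonnegative and
the sum is taken in `ℝ≥0∞`. -/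
theorem wu_inequality (T : ℝ) (hT : 0 < T) (f : ℕ → ℝ) (hf : ∀ k, 0 < f k)
    (h1 : Summable fun k => f k * poissonPMF T k)
    (h2 : Summable fun k => f k * |Real.log (f k)| * poissonPMF T k) :
    ((entPoisson T f : ℝ) : EReal)
      ≤ (T : ℝ) * ((∑' k : ℕ, ENNReal.ofReal (wuTerm T f k) : ℝ≥0∞) : EReal) := by
  have hterm : ∀ k, 0 ≤ wuTerm T f k := fun k =>
    mul_nonneg (entropyBregman_nonneg (hf k) (hf (k + 1))) (by rw [poissonPMF]; positivity)
  have hlog : Summable fun k => f k * Real.log (f k) * poissonPMF T k := by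
    refine h2.of_norm_bounded fun k => le_of_eq ?_
    have hπ : 0 ≤ poissonPMF T k := by
      rw [poissonPMF]
      positivity
    rw [Real.norm_eq_abs, abs_mul, abs_mul, abs_of_pos (hf k), abs_of_nonneg hπ]
  by_cases htop : ∑' k, ENNReal.ofReal (wuTerm T f k) = ⊤
  · rw [htop, EReal.coe_ennreal_top, EReal.coe_mul_top_of_pos hT]
    exact le_top
  · have hsum : Summable (wuTerm T f) :=
      (ENNReal.summable_toReal htop).congr fun k => ENNReal.toReal_ofReal (hterm k)
    rw [← ENNReal.ofReal_tsum_of_nonneg hterm hsum, EReal.coe_ennreal_ofReal,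
      max_eq_left (tsum_nonneg hterm), ← EReal.coe_mul, EReal.coe_le_coe_iff]
    exact entPoisson_le_of_summable hT hf h1 hlog hsum
end

section
/- Let T > 0 and let π_T be the Poisson measure on ℕ with intensity T. Let a, b ∈ ℝ and define f : ℕ → (0,∞) by f(k) = e^{a k + b}. Then equality holds in Wu's inequality: Ent_{π_T}[f] = T · Σ_{k=0}^∞ f(k+1) { log( f(k+1)/f(k) ) − 1 + f(k)/f(k+1) } π_T(k). -/
/-- The exponential moment of the Poisson measure. -/
theorem hasSum_exp_mul_poissonPMF (T a b : ℝ) :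
    HasSum (fun k : ℕ ↦ Real.exp (a * k + b) * poissonPMF T k)
      (Real.exp (b - T + T * Real.exp a)) := by
  have h := (NormedSpace.expSeries_div_hasSum_exp (T * Real.exp a)).mul_left (Real.exp (b - T))
  rw [← Real.exp_eq_exp_ℝ, ← Real.exp_add] at h
  refine h.congr_fun fun k ↦ ?_
  rw [poissonPMF, Real.exp_add, sub_eq_add_neg, Real.exp_add, mul_comm a, Real.exp_nat_mul,
    mul_pow]
  ring

/-- Consecutive values of `k ↦ e^{a k + b}` differ by the factor `e^a`. -/
theorem exp_mul_succ_add (a b : ℝ) (k : ℕ) :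
    Real.exp (a * ((k + 1 : ℕ) : ℝ) + b) = Real.exp a * Real.exp (a * k + b) := by
  rw [← Real.exp_add]
  push_cast
  ring_nf

/-- Shifting the index of the Poisson weights. -/
theorem succ_mul_poissonPMF_succ (T : ℝ) (k : ℕ) :
    ((k + 1 : ℕ) : ℝ) * poissonPMF T (k + 1) = T * poissonPMF T k := by
  have hk : ((k : ℝ) + 1) ≠ 0 := by positivity
  simp only [poissonPMF, Nat.factorial_succ]
  push_cast
  field_simp
  ring

/-- The first moment of the exponentially tilted Poisson measure. -/
theorem hasSum_natCast_mul_exp_mul_poissonPMF (T a b : ℝ) :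
    HasSum (fun k : ℕ ↦ (k : ℝ) * (Real.exp (a * k + b) * poissonPMF T k))
      (T * Real.exp a * Real.exp (b - T + T * Real.exp a)) := by
  rw [← hasSum_nat_add_iff' 1]
  simp only [Finset.sum_range_one, Nat.cast_zero, zero_mul, sub_zero]
  refine ((hasSum_exp_mul_poissonPMF T a b).mul_left (T * Real.exp a)).congr_fun fun k ↦ ?_
  rw [exp_mul_succ_add]
  linear_combination Real.exp a * Real.exp (a * k + b) * succ_mul_poissonPMF_succ T k

/-- For an exponential function, the summand in Wu's inequality is a multiple of `f` itself. -/
theorem wuTerm_exp (T a b : ℝ) (k : ℕ) :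
    wuTerm T (fun k : ℕ ↦ Real.exp (a * k + b)) k =
      (a * Real.exp a - Real.exp a + 1) * (Real.exp (a * k + b) * poissonPMF T k) := by
  simp only [wuTerm]
  rw [exp_mul_succ_add, mul_div_cancel_right₀ _ (Real.exp_ne_zero _), Real.log_exp]
  field_simp

/-- For `f(k) = e^{a k + b}`, equality holds in Wu's inequality. -/
theorem wu_equality_exponential (T : ℝ) (hT : 0 < T) (a b : ℝ) (f : ℕ → ℝ)
    (hf : ∀ k : ℕ, f k = Real.exp (a * k + b)) :
    entPoisson T f = T * ∑' k : ℕ, wuTerm T f k := by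
  obtain rfl : f = fun k : ℕ ↦ Real.exp (a * k + b) := funext hf
  have hM := hasSum_exp_mul_poissonPMF T a b
  have hlog : HasSum
      (fun k : ℕ ↦ Real.exp (a * k + b) * Real.log (Real.exp (a * k + b)) * poissonPMF T k) _ :=
    (((hasSum_natCast_mul_exp_mul_poissonPMF T a b).mul_left a).add (hM.mul_left b)).congr_fun
      fun k ↦ by rw [Real.log_exp]; ring
  simp only [entPoisson, wuTerm_exp]
  rw [hlog.tsum_eq, hM.tsum_eq, (hM.mul_left _).tsum_eq, Real.log_exp]
  ring
end

section
/- Let T > 0 and let π_T be the Poisson measure on ℕ with intensity T. Let f : ℕ → (0,∞) be bounded with Σ_k f(k) π_T(k) < ∞. Then equality Ent_{π_T}[f] = T · Σ_{k=0}^∞ f(k+1) { log( f(k+1)/f(k) ) − 1 + f(k)/f(k+1) } π_T(k) holds if and only if there exist a, b ∈ ℝ such that f(k) = e^{a k + b} for all k ∈ ℕ. -/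
open scoped ENNReal

open MeasureTheory Real Filter Topology
open ProbabilityTheory (poissonMeasure poissonMeasure_singleton integral_poissonMeasure
  integrable_poissonMeasure_iff poissonMeasure_conv_poissonMeasure hasSum_one_poissonMeasure
  poissonMeasure_real_singleton)
open scoped NNReal

/-- The Bregman divergence `v log (v / u) - v + u` of `x ↦ x log x`. -/
noncomputable def logDivergence (u v : ℝ) : ℝ := v * log (v / u) - v + u

lemma logDivergence_eq_klFun {u v : ℝ} (hu : 0 < u) :
    logDivergence u v = u * InformationTheory.klFun (v / u) := by
  unfold logDivergence InformationTheory.klFun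
  field_simp
  ring

lemma logDivergence_nonneg {u v : ℝ} (hu : 0 < u) (hv : 0 < v) : 0 ≤ logDivergence u v := by
  rw [logDivergence_eq_klFun hu]
  exact mul_nonneg hu.le (InformationTheory.klFun_nonneg (by positivity))

lemma logDivergence_eq_zero_iff {u v : ℝ} (hu : 0 < u) (hv : 0 < v) :
    logDivergence u v = 0 ↔ v = u := by
  rw [logDivergence_eq_klFun hu, mul_eq_zero, or_iff_right hu.ne',
    InformationTheory.klFun_eq_zero_iff (by positivity), div_eq_one_iff_eq hu.ne']

/-- The tangent plane decomposition of the 1-homogeneous function `logDivergence`. -/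
lemma logDivergence_eq_add {u v r : ℝ} (hu : 0 < u) (hv : 0 < v) (hr : 0 < r) :
    logDivergence u v = u * (1 - r) + v * log r + logDivergence (r * u) v := by
  unfold logDivergence
  rw [log_div hv.ne' hu.ne', log_div hv.ne' (by positivity), log_mul hr.ne' hu.ne']
  ring

lemma logDivergence_add_le {u v e : ℝ} (hu : 0 < u) (hv : 0 < v) (he : 0 < e) :
    logDivergence (u + e) (v + e) ≤ logDivergence u v := by
  have hr : 0 < (v + e) / (u + e) := by positivity
  have h1 := logDivergence_eq_add hu hv hr
  have h2 := logDivergence_eq_add he he hr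
  have h3 : logDivergence e e = 0 := (logDivergence_eq_zero_iff he he).2 rfl
  have h4 := logDivergence_nonneg (mul_pos hr hu) hv
  have h5 := logDivergence_nonneg (mul_pos hr he) he
  have h6 := logDivergence_eq_add (add_pos hu he) (add_pos hv he) hr
  have h7 : (v + e) / (u + e) * (u + e) = v + e := by field_simp
  rw [h7, (logDivergence_eq_zero_iff (add_pos hv he) (add_pos hv he)).2 rfl] at h6
  linarith

lemma logDivergence_le {c C u v : ℝ} (hc : 0 < c) (hcC : c ≤ C) (hu : c ≤ u) (huC : u ≤ C)
    (hv : 0 < v) (hvC : v ≤ C) : logDivergence u v ≤ C * log (C / c) + C := by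
  unfold logDivergence
  have hu0 : 0 < u := hc.trans_le hu
  have h1 : log (v / u) ≤ log (C / c) := log_le_log (by positivity) (by gcongr; linarith)
  have h2 : 0 ≤ log (C / c) := log_nonneg (by rwa [one_le_div hc])
  have h3 : v * log (v / u) ≤ C * log (C / c) :=
    (mul_le_mul_of_nonneg_left h1 hv.le).trans (mul_le_mul_of_nonneg_right hvC h2)
  linarith

lemma integrable_of_abs_le {μ : Measure ℕ} [IsFiniteMeasure μ] {g : ℕ → ℝ} {C : ℝ}
    (h : ∀ k, |g k| ≤ C) : Integrable g μ :=
  .of_bound .of_discrete C (.of_forall h)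

lemma exists_abs_mul_log_le (M : ℝ) : ∃ C, ∀ x, 0 ≤ x → x ≤ M → |x * log x| ≤ C := by
  obtain ⟨C, hC⟩ := (isCompact_Icc (a := (0 : ℝ)) (b := M)).exists_bound_of_continuousOn
    continuous_mul_log.continuousOn
  exact ⟨C, fun x h0 hM => hC x ⟨h0, hM⟩⟩

lemma integral_pos_of_forall_pos {μ : Measure ℕ} [IsProbabilityMeasure μ] {g : ℕ → ℝ}
    (hg : ∀ k, 0 < g k) (hi : Integrable g μ) : 0 < ∫ k, g k ∂μ := by
  rw [integral_pos_iff_support_of_nonneg (fun k => (hg k).le) hi,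
    Function.support_eq_univ fun k => (hg k).ne']
  simp

/-- The quantitative form of Jensen's inequality for `logDivergence`. -/
lemma integral_logDivergence {μ : Measure ℕ} [IsProbabilityMeasure μ] {u v : ℕ → ℝ}
    (hu : ∀ k, 0 < u k) (hv : ∀ k, 0 < v k) (hui : Integrable u μ) (hvi : Integrable v μ)
    (hi : Integrable (fun k => logDivergence (u k) (v k)) μ) :
    Integrable (fun k => logDivergence ((∫ j, v j ∂μ) / (∫ j, u j ∂μ) * u k) (v k)) μ ∧
    ∫ k, logDivergence (u k) (v k) ∂μ = logDivergence (∫ k, u k ∂μ) (∫ k, v k ∂μ) +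
      ∫ k, logDivergence ((∫ j, v j ∂μ) / (∫ j, u j ∂μ) * u k) (v k) ∂μ := by
  have hU := integral_pos_of_forall_pos hu hui
  have hV := integral_pos_of_forall_pos hv hvi
  set U := ∫ k, u k ∂μ with hUdef
  set V := ∫ k, v k ∂μ with hVdef
  have hr : 0 < V / U := by positivity
  have key : ∀ k, logDivergence (V / U * u k) (v k) =
      logDivergence (u k) (v k) - (u k * (1 - V / U) + v k * log (V / U)) := fun k => by
    rw [logDivergence_eq_add (hu k) (hv k) hr]; ring
  have hlin : Integrable (fun k => u k * (1 - V / U) + v k * log (V / U)) μ :=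
    (hui.mul_const _).add (hvi.mul_const _)
  simp_rw [key]
  refine ⟨hi.sub hlin, ?_⟩
  rw [integral_sub hi hlin, integral_add (hui.mul_const _) (hvi.mul_const _),
    integral_mul_const, integral_mul_const, ← hUdef, ← hVdef]
  unfold logDivergence
  field_simp
  ring

lemma forall_of_ae_poissonMeasure {r : ℝ≥0} (hr : 0 < r) {p : ℕ → Prop}
    (h : ∀ᵐ k ∂poissonMeasure r, p k) (k : ℕ) : p k := by
  refine (ae_iff_of_countable.1 h) k ?_
  rw [poissonMeasure_singleton]
  have : 0 < exp (-r) * (r : ℝ) ^ k / (k.factorial) := by positivity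
  simpa using this

lemma integral_poissonMeasure_add {s t : ℝ≥0} {g : ℕ → ℝ}
    (hg : Integrable g (poissonMeasure (s + t))) :
    ∫ k, g k ∂poissonMeasure (s + t) =
      ∫ k, ∫ j, g (k + j) ∂poissonMeasure t ∂poissonMeasure s := by
  rw [← poissonMeasure_conv_poissonMeasure] at hg ⊢
  exact integral_conv hg

lemma integrable_shift_poissonMeasure {s t : ℝ≥0} (hs : 0 < s) {g : ℕ → ℝ}
    (hg : Integrable g (poissonMeasure (s + t))) (k : ℕ) :
    Integrable (fun j => g (k + j)) (poissonMeasure t) := by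
  rw [← poissonMeasure_conv_poissonMeasure, integrable_conv_iff .of_discrete] at hg
  exact forall_of_ae_poissonMeasure hs hg.1 k

lemma integrable_integral_shift_poissonMeasure {s t : ℝ≥0} {g : ℕ → ℝ}
    (hg : Integrable g (poissonMeasure (s + t))) :
    Integrable (fun k => ∫ j, g (k + j) ∂poissonMeasure t) (poissonMeasure s) := by
  rw [← poissonMeasure_conv_poissonMeasure, integrable_conv_iff .of_discrete] at hg
  exact hg.2.mono .of_discrete (.of_forall fun k =>
    (norm_integral_le_integral_norm _).trans (le_abs_self _))

/-- The Poisson semigroup. -/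
noncomputable def poissonSemigroup (t : ℝ≥0) (f : ℕ → ℝ) (k : ℕ) : ℝ :=
  ∫ j, f (k + j) ∂poissonMeasure t

/-- The entropy of `f` with respect to the Poisson measure, written with integrals. -/
noncomputable def poissonEntropy (t : ℝ≥0) (f : ℕ → ℝ) : ℝ :=
  ∫ k, f k * log (f k) ∂poissonMeasure t -
    (∫ k, f k ∂poissonMeasure t) * log (∫ k, f k ∂poissonMeasure t)

/-- The right-hand side of Wu's inequality for intensity `t`, without the factor `t`. -/
noncomputable def poissonEnergy (t : ℝ≥0) (f : ℕ → ℝ) : ℝ :=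
  ∫ k, logDivergence (f k) (f (k + 1)) ∂poissonMeasure t

lemma integrable_of_pos_of_le {μ : Measure ℕ} [IsFiniteMeasure μ] {g : ℕ → ℝ} {M : ℝ}
    (hg : ∀ k, 0 < g k) (hM : ∀ k, g k ≤ M) : Integrable g μ :=
  integrable_of_abs_le fun k => (abs_of_pos (hg k)).trans_le (hM k)

lemma integrable_mul_log_of_le {μ : Measure ℕ} [IsFiniteMeasure μ] {g : ℕ → ℝ} {M : ℝ}
    (hg : ∀ k, 0 < g k) (hM : ∀ k, g k ≤ M) : Integrable (fun k => g k * log (g k)) μ :=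
  have ⟨_, hC⟩ := exists_abs_mul_log_le M
  integrable_of_abs_le fun k => hC _ (hg k).le (hM k)

lemma poissonSemigroup_pos (t : ℝ≥0) {f : ℕ → ℝ} {M : ℝ} (hf : ∀ k, 0 < f k)
    (hM : ∀ k, f k ≤ M) (k : ℕ) : 0 < poissonSemigroup t f k :=
  integral_pos_of_forall_pos (fun _ => hf _) (integrable_of_pos_of_le (fun _ => hf _) fun _ => hM _)

lemma poissonSemigroup_le (t : ℝ≥0) {f : ℕ → ℝ} {M : ℝ} (hf : ∀ k, 0 < f k)
    (hM : ∀ k, f k ≤ M) (k : ℕ) : poissonSemigroup t f k ≤ M := by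
  have := integral_mono (μ := poissonMeasure t)
    (integrable_of_pos_of_le (fun _ => hf _) fun _ => hM _)
    (integrable_const M) (fun j => hM (k + j))
  simpa [poissonSemigroup] using this

lemma le_poissonSemigroup (t : ℝ≥0) {f : ℕ → ℝ} {c M : ℝ} (hf : ∀ k, 0 < f k)
    (hM : ∀ k, f k ≤ M) (hc : ∀ k, c ≤ f k) (k : ℕ) : c ≤ poissonSemigroup t f k := by
  have := integral_mono (μ := poissonMeasure t) (integrable_const c)
    (integrable_of_pos_of_le (fun _ => hf _) fun _ => hM _) (fun j => hc (k + j))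
  simpa [poissonSemigroup] using this

/-- The chain rule for the entropy. -/
lemma poissonEntropy_add (s t : ℝ≥0) {f : ℕ → ℝ} {M : ℝ} (hf : ∀ k, 0 < f k)
    (hM : ∀ k, f k ≤ M) :
    Integrable (fun k => poissonEntropy t fun j => f (k + j)) (poissonMeasure s) ∧
    poissonEntropy (s + t) f = poissonEntropy s (poissonSemigroup t f) +
      ∫ k, poissonEntropy t (fun j => f (k + j)) ∂poissonMeasure s := by
  have hi : Integrable f (poissonMeasure (s + t)) := integrable_of_pos_of_le hf hM
  have hil : Integrable (fun k => f k * log (f k)) (poissonMeasure (s + t)) :=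
    integrable_mul_log_of_le hf hM
  have h1 := integrable_integral_shift_poissonMeasure hil
  have h2 : Integrable (fun k => poissonSemigroup t f k * log (poissonSemigroup t f k))
      (poissonMeasure s) :=
    integrable_mul_log_of_le (poissonSemigroup_pos t hf hM) (poissonSemigroup_le t hf hM)
  refine ⟨h1.sub h2, ?_⟩
  have h3 : ∫ k, poissonEntropy t (fun j => f (k + j)) ∂poissonMeasure s = _ :=
    integral_sub h1 h2
  rw [h3, poissonEntropy, integral_poissonMeasure_add hi, integral_poissonMeasure_add hil,
    poissonEntropy]
  simp only [poissonSemigroup]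
  ring

/-- The energy is the average of the energies of the translates. -/
lemma poissonEnergy_add {s t : ℝ≥0} {f : ℕ → ℝ}
    (hi : Integrable (fun k => logDivergence (f k) (f (k + 1))) (poissonMeasure (s + t))) :
    Integrable (fun k => poissonEnergy t fun j => f (k + j)) (poissonMeasure s) ∧
    poissonEnergy (s + t) f =
      ∫ k, poissonEnergy t (fun j => f (k + j)) ∂poissonMeasure s := by
  have h1 := integrable_integral_shift_poissonMeasure hi
  have h2 := integral_poissonMeasure_add hi
  exact ⟨h1, h2⟩

lemma poissonEntropy_add_le {s t : ℝ≥0} {f : ℕ → ℝ} {M ε δ : ℝ}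
    (hf : ∀ k, 0 < f k) (hM : ∀ k, f k ≤ M)
    (hi : Integrable (fun k => logDivergence (f k) (f (k + 1))) (poissonMeasure (s + t)))
    (h₁ : poissonEntropy s (poissonSemigroup t f) ≤
      s * poissonEnergy s (poissonSemigroup t f) + ε)
    (h₂ : ∀ k, poissonEntropy t (fun j => f (k + j)) ≤
      t * poissonEnergy t (fun j => f (k + j)) + δ) :
    poissonEntropy (s + t) f ≤
      s * poissonEnergy s (poissonSemigroup t f) + t * poissonEnergy (s + t) f + (ε + δ) := by
  obtain ⟨h3, h4⟩ := poissonEntropy_add s t hf hM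
  obtain ⟨h5, h7⟩ := poissonEnergy_add hi
  have h6 : ∫ k, poissonEntropy t (fun j => f (k + j)) ∂poissonMeasure s ≤
      ∫ k, (t * poissonEnergy t (fun j => f (k + j)) + δ) ∂poissonMeasure s :=
    integral_mono h3 ((h5.const_mul (t : ℝ)).add (integrable_const δ)) h₂
  rw [integral_add (h5.const_mul (t : ℝ)) (integrable_const δ), integral_const_mul, ← h7,
    integral_const, probReal_univ, one_smul] at h6
  linarith

lemma integral_logDivergence_shift {s t : ℝ≥0} (hs : 0 < s) {f : ℕ → ℝ} {M : ℝ}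
    (hf : ∀ k, 0 < f k) (hM : ∀ k, f k ≤ M)
    (hi : Integrable (fun k => logDivergence (f k) (f (k + 1))) (poissonMeasure (s + t)))
    (k : ℕ) :
    Integrable (fun j => logDivergence
      (poissonSemigroup t f (k + 1) / poissonSemigroup t f k * f (k + j)) (f (k + j + 1)))
      (poissonMeasure t) ∧
    poissonEnergy t (fun j => f (k + j)) =
      logDivergence (poissonSemigroup t f k) (poissonSemigroup t f (k + 1)) +
      ∫ j, logDivergence (poissonSemigroup t f (k + 1) / poissonSemigroup t f k * f (k + j))
        (f (k + j + 1)) ∂poissonMeasure t := by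
  have h := integral_logDivergence (μ := poissonMeasure t) (u := fun j => f (k + j))
    (v := fun j => f (k + j + 1)) (fun _ => hf _) (fun _ => hf _)
    (integrable_of_pos_of_le (fun _ => hf _) fun _ => hM _)
    (integrable_of_pos_of_le (fun _ => hf _) fun _ => hM _)
    (integrable_shift_poissonMeasure hs hi k)
  have h1 : poissonSemigroup t f (k + 1) = ∫ j, f (k + j + 1) ∂poissonMeasure t := by
    simp only [poissonSemigroup, add_right_comm]
  rw [h1]
  exact h

lemma logDivergence_poissonSemigroup_le {s t : ℝ≥0} (hs : 0 < s) {f : ℕ → ℝ} {M : ℝ}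
    (hf : ∀ k, 0 < f k) (hM : ∀ k, f k ≤ M)
    (hi : Integrable (fun k => logDivergence (f k) (f (k + 1))) (poissonMeasure (s + t)))
    (k : ℕ) :
    logDivergence (poissonSemigroup t f k) (poissonSemigroup t f (k + 1)) ≤
      poissonEnergy t (fun j => f (k + j)) := by
  rw [(integral_logDivergence_shift hs hf hM hi k).2]
  exact le_add_of_nonneg_right (integral_nonneg fun j => logDivergence_nonneg (mul_pos
    (div_pos (poissonSemigroup_pos t hf hM _) (poissonSemigroup_pos t hf hM _)) (hf _)) (hf _))

/-- The energy decreases along the Poisson semigroup. -/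
lemma poissonEnergy_poissonSemigroup_le {s t : ℝ≥0} (hs : 0 < s) {f : ℕ → ℝ} {M : ℝ}
    (hf : ∀ k, 0 < f k) (hM : ∀ k, f k ≤ M)
    (hi : Integrable (fun k => logDivergence (f k) (f (k + 1))) (poissonMeasure (s + t))) :
    Integrable (fun k => logDivergence (poissonSemigroup t f k) (poissonSemigroup t f (k + 1)))
      (poissonMeasure s) ∧
    poissonEnergy s (poissonSemigroup t f) ≤ poissonEnergy (s + t) f := by
  obtain ⟨h5, h7⟩ := poissonEnergy_add hi
  have h6 : Integrable (fun k => logDivergence (poissonSemigroup t f k)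
      (poissonSemigroup t f (k + 1))) (poissonMeasure s) :=
    h5.mono' .of_discrete (.of_forall fun k => by
      rw [norm_eq_abs, abs_of_nonneg (logDivergence_nonneg (poissonSemigroup_pos t hf hM _)
        (poissonSemigroup_pos t hf hM _))]
      exact logDivergence_poissonSemigroup_le hs hf hM hi k)
  refine ⟨h6, ?_⟩
  rw [h7]
  exact integral_mono h6 h5 (logDivergence_poissonSemigroup_le hs hf hM hi)

lemma poissonMeasure_real_zero_one (h : ℝ≥0) :
    (poissonMeasure h).real {0} = exp (-h) ∧ (poissonMeasure h).real {1} = h * exp (-h) := by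
  simp [poissonMeasure_real_singleton, mul_comm]

lemma integrable_logDivergence {μ : Measure ℕ} [IsFiniteMeasure μ] {u v : ℕ → ℝ} {c C : ℝ}
    (hc : 0 < c) (hu : ∀ k, c ≤ u k) (huC : ∀ k, u k ≤ C) (hv : ∀ k, 0 < v k)
    (hvC : ∀ k, v k ≤ C) : Integrable (fun k => logDivergence (u k) (v k)) μ :=
  integrable_of_abs_le fun k => (abs_of_nonneg (logDivergence_nonneg
    (hc.trans_le (hu k)) (hv k))).trans_le
    (logDivergence_le hc ((hu k).trans (huC k)) (hu k) (huC k) (hv k) (hvC k))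

lemma poissonEntropy_le_integral_logDivergence (h : ℝ≥0) {f : ℕ → ℝ} {c C : ℝ} (hc : 0 < c)
    (hf : ∀ k, c ≤ f k) (hC : ∀ k, f k ≤ C) :
    poissonEntropy h f ≤ ∫ k, logDivergence (f 0) (f k) ∂poissonMeasure h := by
  have hpos : ∀ k, 0 < f k := fun k => hc.trans_le (hf k)
  have hi : Integrable f (poissonMeasure h) := integrable_of_pos_of_le hpos hC
  have hil : Integrable (fun k => f k * log (f k)) (poissonMeasure h) :=
    integrable_mul_log_of_le hpos hC
  have h0 := logDivergence_nonneg (hpos 0) (integral_pos_of_forall_pos hpos hi)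
  have key : ∀ k, logDivergence (f 0) (f k) = f k * log (f k) - (log (f 0) + 1) * f k + f 0 :=
    fun k => by
      unfold logDivergence
      rw [log_div (hpos k).ne' (hpos 0).ne']
      ring
  simp_rw [key]
  have hlin : Integrable (fun k => (log (f 0) + 1) * f k) (poissonMeasure h) := hi.const_mul _
  have hsub : Integrable (fun k => f k * log (f k) - (log (f 0) + 1) * f k) (poissonMeasure h) :=
    hil.sub hlin
  rw [integral_add hsub (integrable_const _), integral_sub hil hlin, integral_const_mul,
    integral_const, probReal_univ, one_smul]
  unfold logDivergence at h0
  rw [log_div (integral_pos_of_forall_pos hpos hi).ne' (hpos 0).ne'] at h0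
  unfold poissonEntropy
  linarith

lemma poissonEntropy_le_small (h : ℝ≥0) {f : ℕ → ℝ} {c C : ℝ} (hc : 0 < c)
    (hf : ∀ k, c ≤ f k) (hC : ∀ k, f k ≤ C) :
    poissonEntropy h f ≤ h * poissonEnergy h f + (C * log (C / c) + C) * h ^ 2 := by
  have hpos : ∀ k, 0 < f k := fun k => hc.trans_le (hf k)
  have hcC : c ≤ C := (hf 0).trans (hC 0)
  set K := C * log (C / c) + C with hK
  set D := logDivergence (f 0) (f 1) with hD
  obtain ⟨p0, p1⟩ := poissonMeasure_real_zero_one h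
  have hKk : ∀ k, logDivergence (f 0) (f k) ≤ K := fun k =>
    logDivergence_le hc hcC (hf 0) (hC 0) (hpos k) (hC k)
  have hK0 : 0 ≤ K := (logDivergence_nonneg (hpos 0) (hpos 1)).trans (hKk 1)
  have hind : ∀ (a : ℝ) (n : ℕ),
      Integrable (Set.indicator {n} fun _ => a) (poissonMeasure h) := fun a n =>
    (integrable_const a).indicator .of_discrete
  have upper : ∫ k, logDivergence (f 0) (f k) ∂poissonMeasure h ≤
      ∫ k, (K + Set.indicator {0} (fun _ => -K) k + Set.indicator {1} (fun _ => D - K) k)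
        ∂poissonMeasure h := by
    refine integral_mono
      (integrable_logDivergence hc (fun _ => hf 0) (fun _ => hC 0) hpos hC)
      (((integrable_const K).add (hind _ _)).add (hind _ _)) fun k => ?_
    rcases k with _ | _ | k
    · simp [(logDivergence_eq_zero_iff (hpos 0) (hpos 0)).2 rfl]
    · simp [hD]
    · simpa using hKk (k + 2)
  have eval : ∫ k, (K + Set.indicator {0} (fun _ => -K) k + Set.indicator {1} (fun _ => D - K) k)
        ∂poissonMeasure h = K - K * exp (-h) + (D - K) * (h * exp (-h)) := by
    have hadd : Integrable (fun k => K + Set.indicator {0} (fun _ => -K) k) (poissonMeasure h) :=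
      (integrable_const K).add (hind _ _)
    rw [integral_add hadd (hind _ _), integral_add (integrable_const K) (hind _ _), integral_const,
      integral_indicator_const _ .of_discrete, integral_indicator_const _ .of_discrete, p0, p1,
      probReal_univ]
    simp only [smul_eq_mul]
    ring
  have lower : exp (-h) * D ≤ poissonEnergy h f := by
    have : ∫ k, Set.indicator {0} (fun _ => D) k ∂poissonMeasure h ≤ poissonEnergy h f := by
      refine integral_mono (hind _ _)
        (integrable_logDivergence hc hf hC (fun _ => hpos _) fun _ => hC _) fun k => ?_
      rcases k with _ | k
      · simp [hD]
      · simpa using logDivergence_nonneg (hpos (k + 1)) (hpos (k + 1 + 1))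
    rwa [integral_indicator_const _ .of_discrete, p0, smul_eq_mul] at this
  have hexp : 1 - exp (-h) - h * exp (-h) ≤ (h : ℝ) ^ 2 := by
    nlinarith [add_one_le_exp (-(h : ℝ)), h.coe_nonneg]
  have e1 := poissonEntropy_le_integral_logDivergence h hc hf hC
  have e2 := mul_le_mul_of_nonneg_left hexp hK0
  have e3 := mul_le_mul_of_nonneg_left lower h.coe_nonneg
  rw [eval] at upper
  linarith

lemma poissonEntropy_le_nat_mul {h : ℝ≥0} (hh : 0 < h) {c C : ℝ} (hc : 0 < c) (n : ℕ) :
    ∀ f : ℕ → ℝ, (∀ k, c ≤ f k) → (∀ k, f k ≤ C) →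
    poissonEntropy ((n + 1) * h) f ≤ ((n + 1) * h : ℝ≥0) * poissonEnergy ((n + 1) * h) f +
      (n + 1) * ((C * log (C / c) + C) * h ^ 2) := by
  induction n with
  | zero =>
    intro f hf hC
    simpa using poissonEntropy_le_small h hc hf hC
  | succ n ih =>
    intro f hf hC
    have hpos : ∀ k, 0 < f k := fun k => hc.trans_le (hf k)
    have hs : 0 < ((n : ℝ≥0) + 1) * h := by positivity
    have hi : Integrable (fun k => logDivergence (f k) (f (k + 1)))
        (poissonMeasure ((n + 1) * h + h)) :=
      integrable_logDivergence hc hf hC (fun _ => hpos _) fun _ => hC _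
    have h1 := poissonEntropy_add_le hpos hC hi
      (ih _ (le_poissonSemigroup h hpos hC hf) (poissonSemigroup_le h hpos hC))
      (fun k => poissonEntropy_le_small h hc (fun _ => hf _) fun _ => hC _)
    have h2 := mul_le_mul_of_nonneg_left
      (poissonEnergy_poissonSemigroup_le hs hpos hC hi).2 ((n + 1) * h : ℝ≥0).coe_nonneg
    have h3 : ((n + 1 : ℕ) + 1) * h = (n + 1) * h + h := by push_cast; ring
    rw [h3]
    simp only [NNReal.coe_add, NNReal.coe_mul, NNReal.coe_natCast, NNReal.coe_one,
      Nat.cast_add, Nat.cast_one] at h1 h2 ⊢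
    linarith

lemma poissonEntropy_le_of_le {t : ℝ≥0} (ht : 0 < t) {f : ℕ → ℝ} {c C : ℝ} (hc : 0 < c)
    (hf : ∀ k, c ≤ f k) (hC : ∀ k, f k ≤ C) :
    poissonEntropy t f ≤ t * poissonEnergy t f := by
  have hlim : Tendsto (fun n : ℕ => t * poissonEnergy t f +
      ((C * log (C / c) + C) * t ^ 2) * (1 / ((n : ℝ) + 1))) atTop
      (𝓝 (t * poissonEnergy t f + ((C * log (C / c) + C) * t ^ 2) * 0)) :=
    (tendsto_one_div_add_atTop_nhds_zero_nat.const_mul _).const_add _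
  rw [mul_zero, add_zero] at hlim
  refine ge_of_tendsto' hlim fun n => ?_
  have hn : (0 : ℝ≥0) < n + 1 := by positivity
  have h1 := poissonEntropy_le_nat_mul (h := t / (n + 1)) (by positivity) hc n f hf hC
  rw [mul_div_cancel₀ _ hn.ne'] at h1
  refine h1.trans_eq ?_
  have : (n : ℝ) + 1 ≠ 0 := by positivity
  push_cast
  field_simp

/-- Wu's modified logarithmic Sobolev inequality for bounded positive functions. -/
lemma poissonEntropy_le {t : ℝ≥0} (ht : 0 < t) {f : ℕ → ℝ} {M : ℝ}
    (hf : ∀ k, 0 < f k) (hM : ∀ k, f k ≤ M)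
    (hi : Integrable (fun k => logDivergence (f k) (f (k + 1))) (poissonMeasure t)) :
    poissonEntropy t f ≤ t * poissonEnergy t f := by
  have he : ∀ n : ℕ, 0 < 1 / ((n : ℝ) + 1) := fun n => by positivity
  have he1 : ∀ n : ℕ, 1 / ((n : ℝ) + 1) ≤ 1 := fun n => by
    rw [div_le_one (by positivity)]; linarith [n.cast_nonneg (α := ℝ)]
  have hpos : ∀ (n : ℕ) k, 0 < f k + 1 / ((n : ℝ) + 1) := fun n k => add_pos (hf k) (he _)
  have hbd : ∀ (n : ℕ) k, f k + 1 / ((n : ℝ) + 1) ≤ M + 1 := fun n k => add_le_add (hM k) (he1 n)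
  have hptw : ∀ k, Tendsto (fun n : ℕ => f k + 1 / ((n : ℝ) + 1)) atTop (𝓝 (f k)) := fun k => by
    simpa using tendsto_one_div_add_atTop_nhds_zero_nat.const_add (f k)
  have lim1 : Tendsto (fun n : ℕ => ∫ k, (f k + 1 / ((n : ℝ) + 1)) ∂poissonMeasure t) atTop
      (𝓝 (∫ k, f k ∂poissonMeasure t)) := by
    refine tendsto_integral_of_dominated_convergence (fun _ => M + 1) (fun _ => .of_discrete)
      (integrable_const _) (fun n => .of_forall fun k => ?_) (.of_forall hptw)
    rw [norm_eq_abs, abs_of_pos (hpos n k)]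
    exact hbd n k
  obtain ⟨B, hB⟩ := exists_abs_mul_log_le (M + 1)
  have lim2 : Tendsto (fun n : ℕ => ∫ k, (f k + 1 / ((n : ℝ) + 1)) *
      log (f k + 1 / ((n : ℝ) + 1)) ∂poissonMeasure t) atTop
      (𝓝 (∫ k, f k * log (f k) ∂poissonMeasure t)) :=
    tendsto_integral_of_dominated_convergence (fun _ => B) (fun _ => .of_discrete)
      (integrable_const _) (fun n => .of_forall fun k => hB _ (hpos n k).le (hbd n k))
      (.of_forall fun k => (continuous_mul_log.tendsto _).comp (hptw k))
  refine le_of_tendsto' (lim2.sub ((continuous_mul_log.tendsto _).comp lim1)) fun n => ?_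
  have h1 := poissonEntropy_le_of_le ht (he n) (f := fun k => f k + 1 / ((n : ℝ) + 1))
    (fun k => by linarith [hf k]) (hbd n)
  refine h1.trans (mul_le_mul_of_nonneg_left (integral_mono ?_ hi fun k => ?_) t.coe_nonneg)
  · exact integrable_logDivergence (he n) (fun k => by linarith [hf k]) (hbd n)
      (fun _ => hpos _ _) fun _ => hbd _ _
  · exact logDivergence_add_le (hf k) (hf (k + 1)) (he n)

/-- In the equality case of Wu's inequality the function is a geometric sequence. -/
lemma exists_ratio_of_poissonEntropy_eq {s : ℝ≥0} (hs : 0 < s) {f : ℕ → ℝ} {M : ℝ}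
    (hf : ∀ k, 0 < f k) (hM : ∀ k, f k ≤ M)
    (hi : Integrable (fun k => logDivergence (f k) (f (k + 1))) (poissonMeasure (s + s)))
    (heq : poissonEntropy (s + s) f = (s + s) * poissonEnergy (s + s) f) :
    ∃ r : ℝ, 0 < r ∧ ∀ k, f (k + 1) = r * f k := by
  obtain ⟨hgi, -⟩ := poissonEnergy_poissonSemigroup_le hs hf hM hi
  have gpos := poissonSemigroup_pos s hf hM
  have hle := poissonEntropy_add_le (ε := 0) (δ := 0) hf hM hi
    ((poissonEntropy_le hs gpos (poissonSemigroup_le s hf hM) hgi).trans_eq (add_zero _).symm)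
    (fun k => (poissonEntropy_le hs (fun j => hf (k + j)) (fun j => hM (k + j))
      (integrable_shift_poissonMeasure hs hi k)).trans_eq (add_zero _).symm)
  obtain ⟨hEi, hE⟩ := poissonEnergy_add hi
  have hs' : (0 : ℝ) < s := hs
  have hge : poissonEnergy (s + s) f ≤ poissonEnergy s (poissonSemigroup s f) := by
    refine le_of_mul_le_mul_left ?_ hs'
    linarith
  have hzero : ∫ k, (poissonEnergy s (fun j => f (k + j)) - logDivergence
      (poissonSemigroup s f k) (poissonSemigroup s f (k + 1))) ∂poissonMeasure s = 0 := by
    refine le_antisymm ?_ (integral_nonneg fun k =>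
      sub_nonneg.2 (logDivergence_poissonSemigroup_le hs hf hM hi k))
    rw [integral_sub hEi hgi, ← hE]
    exact sub_nonpos.2 hge
  rw [integral_eq_zero_iff_of_nonneg (fun k =>
    sub_nonneg.2 (logDivergence_poissonSemigroup_le hs hf hM hi k)) (hEi.sub hgi)] at hzero
  have h0 := forall_of_ae_poissonMeasure hs hzero 0
  obtain ⟨hJi, hJ⟩ := integral_logDivergence_shift hs hf hM hi 0
  have hr := div_pos (gpos (0 + 1)) (gpos 0)
  set r := poissonSemigroup s f (0 + 1) / poissonSemigroup s f 0
  simp only [hJ, add_sub_cancel_left, Pi.zero_apply] at h0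
  have hnn : ∀ j, 0 ≤ logDivergence (r * f (0 + j)) (f (0 + j + 1)) := fun j =>
    logDivergence_nonneg (mul_pos hr (hf _)) (hf _)
  rw [integral_eq_zero_iff_of_nonneg hnn hJi] at h0
  refine ⟨r, hr, fun k => ?_⟩
  have hk := forall_of_ae_poissonMeasure hs h0 k
  simp only [zero_add, Pi.zero_apply] at hk
  exact (logDivergence_eq_zero_iff (mul_pos hr (hf _)) (hf _)).1 hk

lemma poissonPMF_nonneg {t : ℝ} (ht : 0 ≤ t) (k : ℕ) : 0 ≤ poissonPMF t k := by
  unfold poissonPMF; positivity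

lemma hasSum_poissonPMF {t : ℝ} (ht : 0 ≤ t) : HasSum (poissonPMF t) 1 :=
  hasSum_one_poissonMeasure ⟨t, ht⟩

lemma hasSum_mul_poissonPMF {t : ℝ} (ht : 0 ≤ t) :
    HasSum (fun k : ℕ => k * poissonPMF t k) t := by
  rw [← hasSum_nat_add_iff' 1]
  convert! (hasSum_poissonPMF ht).mul_left t using 1
  · ext k
    unfold poissonPMF
    rw [Nat.factorial_succ]
    push_cast
    field_simp
    ring
  · simp

/-- Exponential functions tilt a Poisson distribution into another one. -/
lemma exp_mul_poissonPMF (t a b : ℝ) (k : ℕ) :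
    exp (a * k + b) * poissonPMF t k =
      exp (b + t * (exp a - 1)) * poissonPMF (t * exp a) k := by
  have h1 : exp (a * k + b) = exp a ^ k * exp b := by rw [exp_add, mul_comm a, exp_nat_mul]
  have h2 : exp (b + t * (exp a - 1)) * exp (-(t * exp a)) = exp b * exp (-t) := by
    rw [← exp_add, ← exp_add]; congr 1; ring
  unfold poissonPMF
  rw [h1, mul_pow]
  linear_combination (-(t ^ k * exp a ^ k) / k.factorial) * h2

lemma wuTerm_eq {T : ℝ} {f : ℕ → ℝ} (hf : ∀ k, 0 < f k) (k : ℕ) :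
    wuTerm T f k = logDivergence (f k) (f (k + 1)) * poissonPMF T k := by
  have := (hf (k + 1)).ne'
  unfold wuTerm logDivergence
  field_simp

lemma entPoisson_exp {T : ℝ} (hT : 0 < T) (a b : ℝ) :
    Summable (wuTerm T fun k => exp (a * k + b)) ∧
    entPoisson T (fun k => exp (a * k + b)) =
      T * ∑' k, wuTerm T (fun k => exp (a * k + b)) k := by
  set Z := exp (b + T * (exp a - 1)) with hZ
  have hm : 0 ≤ T * exp a := by positivity
  have h1 : HasSum (fun k : ℕ => exp (a * k + b) * poissonPMF T k) Z := by
    simp_rw [exp_mul_poissonPMF, ← hZ]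
    simpa using (hasSum_poissonPMF hm).mul_left Z
  have h2 : HasSum (fun k : ℕ => exp (a * k + b) * log (exp (a * k + b)) * poissonPMF T k)
      (a * Z * (T * exp a) + b * Z) := by
    convert! ((hasSum_mul_poissonPMF hm).mul_left (a * Z)).add (h1.mul_left b) using 1
    ext k
    rw [log_exp, exp_mul_poissonPMF]
    linear_combination (a * k + b) * exp_mul_poissonPMF T a b k
  have h3 : HasSum (wuTerm T fun k => exp (a * k + b)) ((exp a * a - exp a + 1) * Z) := by
    convert! h1.mul_left (exp a * a - exp a + 1) using 1
    ext k
    rw [wuTerm_eq (fun _ => exp_pos _)]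
    unfold logDivergence
    rw [← exp_sub, log_exp]
    have : exp (a * (k + 1 : ℕ) + b) = exp a * exp (a * k + b) := by
      rw [← exp_add]; congr 1; push_cast; ring
    rw [this]
    push_cast
    ring
  refine ⟨h3.summable, ?_⟩
  rw [entPoisson, h1.tsum_eq, h2.tsum_eq, h3.tsum_eq, hZ, log_exp]
  ring

lemma entPoisson_eq_poissonEntropy (t : ℝ≥0) (f : ℕ → ℝ) :
    entPoisson t f = poissonEntropy t f := by
  simp only [entPoisson, poissonEntropy, integral_poissonMeasure, smul_eq_mul, poissonPMF,
    mul_comm]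

lemma tsum_wuTerm_eq_poissonEnergy (t : ℝ≥0) {f : ℕ → ℝ} (hf : ∀ k, 0 < f k) :
    ∑' k, wuTerm t f k = poissonEnergy t f := by
  simp only [wuTerm_eq hf, poissonEnergy, integral_poissonMeasure, smul_eq_mul, poissonPMF,
    mul_comm]

lemma integrable_logDivergence_of_summable_wuTerm (t : ℝ≥0) {f : ℕ → ℝ} (hf : ∀ k, 0 < f k)
    (h : Summable (wuTerm t f)) :
    Integrable (fun k => logDivergence (f k) (f (k + 1))) (poissonMeasure t) := by
  rw [integrable_poissonMeasure_iff]
  refine h.congr fun k => ?_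
  rw [wuTerm_eq hf, norm_eq_abs, abs_of_nonneg (logDivergence_nonneg (hf _) (hf _)), mul_comm]
  rfl

/-- Characterization of the equality cases of Wu's inequality: for bounded positive `f`,
equality holds if and only if `f(k) = e^{a k + b}` for some `a, b ∈ ℝ`. The right-hand side
is interpreted as an extended real, each summand being nonnegative. -/
theorem wu_equality_iff (T : ℝ) (hT : 0 < T) (f : ℕ → ℝ) (hf : ∀ k, 0 < f k)
    (hbd : ∃ M : ℝ, ∀ k, f k ≤ M)
    (h1 : Summable fun k => f k * poissonPMF T k) :
    ((entPoisson T f : ℝ) : EReal)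
        = (T : ℝ) * ((∑' k : ℕ, ENNReal.ofReal (wuTerm T f k) : ℝ≥0∞) : EReal)
      ↔ ∃ a b : ℝ, ∀ k : ℕ, f k = Real.exp (a * k + b) := by
  obtain ⟨M, hM⟩ := hbd
  have hnn : ∀ k, 0 ≤ wuTerm T f k := fun k => by
    rw [wuTerm_eq hf]
    exact mul_nonneg (logDivergence_nonneg (hf _) (hf _)) (poissonPMF_nonneg hT.le k)
  have hcoe : Summable (wuTerm T f) →
      (T : ℝ) * ((∑' k : ℕ, ENNReal.ofReal (wuTerm T f k) : ℝ≥0∞) : EReal) =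
        ((T * ∑' k, wuTerm T f k : ℝ) : EReal) := fun hsum => by
    rw [← ENNReal.ofReal_tsum_of_nonneg hnn hsum, EReal.coe_ennreal_ofReal,
      max_eq_left (tsum_nonneg hnn), EReal.coe_mul]
  constructor
  · intro h
    have hsum : Summable (wuTerm T f) := by
      have hne : ∑' k : ℕ, ENNReal.ofReal (wuTerm T f k) ≠ ⊤ := fun htop => by
        rw [htop, EReal.coe_ennreal_top, EReal.coe_mul_top_of_pos hT] at h
        exact EReal.coe_ne_top _ h
      simpa only [ENNReal.toReal_ofReal (hnn _)] using ENNReal.summable_toReal hne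
    rw [hcoe hsum, EReal.coe_eq_coe_iff] at h
    obtain ⟨s, hs, rfl⟩ : ∃ s : ℝ≥0, 0 < s ∧ T = (s + s : ℝ≥0) :=
      ⟨⟨T / 2, by positivity⟩, half_pos hT, (add_halves T).symm⟩
    rw [entPoisson_eq_poissonEntropy, tsum_wuTerm_eq_poissonEnergy _ hf] at h
    obtain ⟨r, hr, hrec⟩ := exists_ratio_of_poissonEntropy_eq hs hf hM
      (integrable_logDivergence_of_summable_wuTerm _ hf hsum) (by exact_mod_cast h)
    refine ⟨log r, log (f 0), fun k => ?_⟩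
    induction k with
    | zero => simp [exp_log (hf 0)]
    | succ k ih =>
      rw [hrec, ih]
      nth_rw 1 [← exp_log hr]
      rw [← exp_add]
      congr 1
      push_cast
      ring
  · rintro ⟨a, b, hab⟩
    obtain rfl : f = fun k : ℕ => exp (a * k + b) := funext hab
    obtain ⟨hsum, heq⟩ := entPoisson_exp hT a b
    rw [hcoe hsum, heq]
end

section
/- For every c > 0, the function z ↦ Θ_c(z) := (z²/(1+cz)) log(1/(1+cz)) − z²/(1+cz) + z² is monotone increasing on [0,∞). -/
/-- The function `Θ_c(z) = (z²/(1+cz)) log(1/(1+cz)) − z²/(1+cz) + z²`. -/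
noncomputable def Theta (c z : ℝ) : ℝ :=
  z ^ 2 / (1 + c * z) * Real.log (1 / (1 + c * z)) - z ^ 2 / (1 + c * z) + z ^ 2

theorem one_add_log_div_self_antitoneOn :
    AntitoneOn (fun u : ℝ => (1 + Real.log u) / u) (Set.Ici 1) := by
  intro u hu v hv huv
  have hu1 : (1 : ℝ) ≤ u := hu
  have hu0 : 0 < u := by linarith
  have hv0 : 0 < v := by linarith
  have hlog : Real.log v - Real.log u ≤ v / u - 1 := by
    rw [← Real.log_div hv0.ne' hu0.ne']
    exact Real.log_le_sub_one_of_pos (div_pos hv0 hu0)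
  have hmul : u * (Real.log v - Real.log u) ≤ v - u := by
    calc u * (Real.log v - Real.log u) ≤ u * (v / u - 1) := by gcongr
      _ = v - u := by field_simp
  have hnonneg : 0 ≤ (v - u) * Real.log u :=
    mul_nonneg (sub_nonneg.2 huv) (Real.log_nonneg hu1)
  change (1 + Real.log v) / v ≤ (1 + Real.log u) / u
  rw [div_le_div_iff₀ hv0 hu0]
  linarith

theorem Theta_eq_sq_mul (c z : ℝ) :
    Theta c z = z ^ 2 * (1 - (1 + Real.log (1 + c * z)) / (1 + c * z)) := by
  rw [Theta, one_div, Real.log_inv]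
  ring

/-- For every `c > 0`, the function `z ↦ Θ_c(z)` is monotone increasing on `[0,∞)`. -/
theorem theta_monotone (c : ℝ) (hc : 0 < c) :
    MonotoneOn (fun z => Theta c z) (Set.Ici (0 : ℝ)) := by
  intro x hx y hy hxy
  have hx0 : (0 : ℝ) ≤ x := hx
  have hux : 1 ≤ 1 + c * x := le_add_of_nonneg_right (mul_nonneg hc.le hx0)
  have huxy : 1 + c * x ≤ 1 + c * y := by gcongr
  have hanti : (1 + Real.log (1 + c * y)) / (1 + c * y) ≤
      (1 + Real.log (1 + c * x)) / (1 + c * x) :=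
    one_add_log_div_self_antitoneOn hux (hux.trans huxy) huxy
  have hle_one : (1 + Real.log (1 + c * x)) / (1 + c * x) ≤ 1 := by
    simpa using one_add_log_div_self_antitoneOn (Set.mem_Ici.2 le_rfl) hux hux
  simp only [Theta_eq_sq_mul]
  exact mul_le_mul (pow_le_pow_left₀ hx0 hxy 2) (by linarith) (by linarith) (sq_nonneg y)
end

section
/- For every c > 0, the function z ↦ Θ_c(z) := (z²/(1+cz)) log(1/(1+cz)) − z²/(1+cz) + z² is convex on [0,∞). -/
/-- The function `Θ_1`, written in the variable `u = 1 + z`, is convex on `[1,∞)`. -/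
theorem convexOn_sq_sub_mul_one_add_log :
    ConvexOn ℝ (Set.Ici (1 : ℝ))
      (fun u => (u - 1) ^ 2 - (u - 2 + u⁻¹) * (1 + Real.log u)) := by
  refine convexOn_of_hasDerivWithinAt2_nonneg (convex_Ici 1)
    (f' := fun u => 2 * (u - 1) -
      ((1 - (u ^ 2)⁻¹) * (1 + Real.log u) + (u - 2 + u⁻¹) * u⁻¹))
    (f'' := fun u => (2 * u ^ 3 - u ^ 2 - 2 * u + 1 - 2 * Real.log u) / u ^ 3) ?_ ?_ ?_ ?_
  · have h : ∀ u ∈ Set.Ici (1 : ℝ), u ≠ 0 := fun u hu =>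
      (zero_lt_one.trans_le (Set.mem_Ici.mp hu)).ne'
    fun_prop (disch := assumption)
  · intro u hu
    rw [interior_Ici, Set.mem_Ioi] at hu
    have hu0 : u ≠ 0 := by positivity
    have h := (((hasDerivAt_id u).sub_const 1).pow 2).sub
      ((((hasDerivAt_id u).sub_const 2).add (hasDerivAt_inv hu0)).mul
        ((Real.hasDerivAt_log hu0).const_add 1))
    refine (h.congr_deriv ?_).hasDerivWithinAt
    simp only [Pi.add_apply, id_eq, Nat.cast_ofNat]
    ring
  · intro u hu
    rw [interior_Ici, Set.mem_Ioi] at hu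
    have hu0 : u ≠ 0 := by positivity
    have hd := ((hasDerivAt_id u).sub_const 2).add (hasDerivAt_inv hu0)
    have h := (((hasDerivAt_id u).sub_const 1).const_mul 2).sub
      ((((((hasDerivAt_id u).pow 2).inv (pow_ne_zero 2 hu0)).const_sub 1).mul
        ((Real.hasDerivAt_log hu0).const_add 1)).add (hd.mul (hasDerivAt_inv hu0)))
    refine (h.congr_deriv ?_).hasDerivWithinAt
    simp
    field_simp
    ring
  · intro u hu
    rw [interior_Ici, Set.mem_Ioi] at hu
    have hlog := Real.log_le_sub_one_of_pos (zero_lt_one.trans hu)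
    have hpoly : 0 ≤ (u - 1) ^ 2 * (2 * u + 3) := by positivity
    exact div_nonneg (by linarith) (by positivity)

/-- For every `c > 0`, the function `z ↦ Θ_c(z)` is convex on `[0,∞)`. -/
theorem theta_convex (c : ℝ) (hc : 0 < c) :
    ConvexOn ℝ (Set.Ici (0 : ℝ)) (fun z => Theta c z) := by
  have h := (convexOn_sq_sub_mul_one_add_log.comp_affineMap
    (AffineMap.lineMap (1 : ℝ) (1 + c))).smul (inv_nonneg.mpr (sq_nonneg c))
  refine (h.subset ?_ (convex_Ici 0)).congr ?_
  · intro z hz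
    simpa [AffineMap.lineMap_apply] using mul_nonneg (Set.mem_Ici.mp hz) hc.le
  · intro z hz
    have hz0 : 0 ≤ z := hz
    have hpos : 0 < 1 + c * z := by positivity
    have hline : AffineMap.lineMap (1 : ℝ) (1 + c) z = 1 + c * z := by
      simp [AffineMap.lineMap_apply]
      ring
    simp only [Function.comp_apply, hline, smul_eq_mul, Theta, one_div, Real.log_inv]
    field_simp
    ring
end

section
/- Let f : ℕ → (0,∞) be ultra-log-concave and set c := f(0)/f(1). Then for every k ∈ ℕ, f(k+2) f(k) / f(k+1)² ≤ 1 / (1 + c·f(k+1)/f(k)) < 1. -/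
/-- `f : ℕ → ℝ` is ultra-log-concave: `k f(k)² ≥ (k+1) f(k+1) f(k−1)` for all `k ∈ ℕ`,
with the convention `f(−1) := 0` (the case `k = 0` is vacuous, so we state the condition
for `k + 1`, `k ∈ ℕ`). -/
def UltraLogConcave (f : ℕ → ℝ) : Prop :=
  ∀ k : ℕ, ((k : ℝ) + 2) * f (k + 2) * f k ≤ ((k : ℝ) + 1) * (f (k + 1)) ^ 2

/-- For ultra-log-concave `f`, the ratio `f (k + 1) / f k` is at most `(f 1 / f 0) / (k + 1)`,
in denominator-free form. -/
theorem UltraLogConcave.succ_mul_mul_le {f : ℕ → ℝ} (hulc : UltraLogConcave f)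
    (hf : ∀ k, 0 < f k) (k : ℕ) : ((k : ℝ) + 1) * (f 0 * f (k + 1)) ≤ f 1 * f k := by
  induction k with
  | zero => simp [mul_comm]
  | succ k ih =>
    refine le_of_mul_le_mul_right ?_ (hf k)
    have h₁ := mul_le_mul_of_nonneg_left (hulc k) (hf 0).le
    have h₂ := mul_le_mul_of_nonneg_right ih (hf (k + 1)).le
    push_cast
    linarith

/-- For ultra-log-concave `f : ℕ → (0,∞)` and `c := f(0)/f(1)`, one has
`f(k+2) f(k) / f(k+1)² ≤ 1/(1 + c f(k+1)/f(k)) < 1` for every `k ∈ ℕ`. -/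
theorem ulc_ratio_bound (f : ℕ → ℝ) (hf : ∀ k, 0 < f k) (hulc : UltraLogConcave f)
    (k : ℕ) :
    f (k + 2) * f k / (f (k + 1)) ^ 2 ≤ 1 / (1 + f 0 / f 1 * (f (k + 1) / f k)) ∧
    1 / (1 + f 0 / f 1 * (f (k + 1) / f k)) < 1 := by
  have h₀ := hf 0
  have h₁ := hf 1
  have hk := hf k
  have hk₁ := hf (k + 1)
  have hpos : 0 < f 0 / f 1 * (f (k + 1) / f k) := by positivity
  have hk₂ : (0 : ℝ) < (k : ℝ) + 1 := by positivity
  have hratio : f 0 / f 1 * (f (k + 1) / f k) ≤ 1 / ((k : ℝ) + 1) := by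
    rw [div_mul_div_comm, div_le_div_iff₀ (by positivity) hk₂]
    linarith [hulc.succ_mul_mul_le hf k]
  refine ⟨?_, by rw [div_lt_one (by linarith)]; linarith⟩
  calc f (k + 2) * f k / f (k + 1) ^ 2 ≤ ((k : ℝ) + 1) / ((k : ℝ) + 2) := by
        rw [div_le_div_iff₀ (by positivity) (by positivity)]
        linarith [hulc k]
    _ = 1 / (1 + 1 / ((k : ℝ) + 1)) := by
        field_simp
        ring
    _ ≤ 1 / (1 + f 0 / f 1 * (f (k + 1) / f k)) :=
        one_div_le_one_div_of_le (by linarith) (by linarith)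
end
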